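/- arXiv:2110.09311 — 4 statements merged into one kernel-verified Lean document; each statement's English description precedes it below -/
import Mathlib

section
/- Let L be a real vector space with Module.finrank ℝ L = 1 (a line) and let n : ℕ. Consider the canonical full-contraction pairing between the n-th tensor power of the dual, ⨂[ℝ]^n (L →ₗ[ℝ] ℝ), and the n-th tensor power ⨂[ℝ]^n L, namely the bilinear map sending elementary tensors (α₁ ⊗ ⋯ ⊗ αₙ, a₁ ⊗ ⋯ ⊗ aₙ) to the product ∏ᵢ αᵢ(aᵢ). Then for every nonzero x ∈ ⨂[ℝ]^n L there exists a unique η ∈ ⨂[ℝ]^n (L →ₗ[ℝ] ℝ) such that the pairing of η and x equals 1. -/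
open TensorProduct Module

theorem finrank_piTensorProduct_of_finrank_eq_one {ι K : Type*} [Finite ι] [Field K]
    {M : ι → Type*} [∀ i, AddCommGroup (M i)] [∀ i, Module K (M i)]
    (h : ∀ i, finrank K (M i) = 1) : finrank K (⨂[K] i, M i) = 1 := by
  rw [finrank_eq_nat_card_basis (Basis.piTensorProduct fun i => basisUnique Unit (h i))]
  simp

theorem existsUnique_dual_apply_eq_one {K V : Type*} [Field K] [AddCommGroup V] [Module K V]
    (h : finrank K V = 1) {x : V} (hx : x ≠ 0) : ∃! f : Dual K V, f x = 1 := by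
  have hb : ∀ v, ∃ c : K, c • x = v := (finrank_eq_one_iff_of_nonzero' x hx).mp h
  obtain ⟨f, hf⟩ := Projective.exists_dual_ne_zero K hx
  refine ⟨(f x)⁻¹ • f, inv_mul_cancel₀ hf, fun g hg => LinearMap.ext fun v => ?_⟩
  obtain ⟨c, rfl⟩ := hb v
  simp [hg, hf]

/-- Let `L` be a line (`finrank ℝ L = 1`) and `n : ℕ`. Consider the
canonical full-contraction pairing `B` between `⨂[ℝ]^n (L →ₗ[ℝ] ℝ)` and `⨂[ℝ]^n L`,
determined on elementary tensors by `B (α₁ ⊗ ⋯ ⊗ αₙ) (a₁ ⊗ ⋯ ⊗ aₙ) = ∏ i, αᵢ (aᵢ)`.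
Then every nonzero `x ∈ ⨂[ℝ]^n L` admits a unique `η` with `B η x = 1`. -/
theorem tensor_power_inverse (L : Type*) [AddCommGroup L] [Module ℝ L]
    (hL : finrank ℝ L = 1) (n : ℕ) :
    ∃ B : TensorPower ℝ n (L →ₗ[ℝ] ℝ) →ₗ[ℝ] TensorPower ℝ n L →ₗ[ℝ] ℝ,
      (∀ (α : Fin n → (L →ₗ[ℝ] ℝ)) (a : Fin n → L),
        B (PiTensorProduct.tprod ℝ α) (PiTensorProduct.tprod ℝ a) = ∏ i, (α i) (a i)) ∧
      ∀ x : TensorPower ℝ n L, x ≠ 0 → ∃! η : TensorPower ℝ n (L →ₗ[ℝ] ℝ), B η x = 1 := by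
  have : FiniteDimensional ℝ L := Module.finite_of_finrank_eq_succ hL
  refine ⟨PiTensorProduct.dualDistrib, PiTensorProduct.dualDistrib_apply, fun x hx => ?_⟩
  let e := PiTensorProduct.dualDistribEquiv (R := ℝ) (M := fun _ : Fin n => L)
  exact (e.bijective.existsUnique_iff (p := fun f => f x = 1)).mp
    (existsUnique_dual_apply_eq_one (finrank_piTensorProduct_of_finrank_eq_one fun _ => hL) hx)
end

section
/- Let G be a commutative monoid, (R g)_{g ∈ G} a dimensioned ring over G, D a set with a monoid action of G (denoted g • d), and (A d)_{d ∈ D} a dimensioned module over R: a family of additive commutative groups together with biadditive scalar multiplication maps R g → A d → A (g • d) satisfying (r*s) • a = r • (s • a) and 1 • a = a up to canonical transport along index equalities. Let I be a dimensioned ideal of R, and let S be a dimensioned submodule of A (a family of additive subgroups S d ≤ A d with r • s ∈ S (g • d) for all r ∈ R g, s ∈ S d) such that I • A ⊆ S, i.e. i • a ∈ S (g • d) for all i ∈ I g, a ∈ A d. Then the family of quotient groups d ↦ A d ⧸ S d carries a well-defined dimensioned module structure over the quotient dimensioned ring g ↦ R g ⧸ I g, uniquely determined by (r + I g) • (a +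 S d) = r • a + S (g • d), and the family of quotient projections Q : A d → A d ⧸ S d satisfies Q(r • a) = q(r) • Q(a), where q : R g → R g ⧸ I g is the quotient ring projection. -/
universe u v w x

/-- Canonical transport of elements of a type family along an equality of indices. -/
def dcast {D : Type u} (A : D → Type v) {d e : D} (h : d = e) : A d → A e :=
  fun a => cast (congrArg A h) a

/-- A dimensioned (commutative, unital) ring over a commutative monoid `G` of dimensions. -/
structure DimRingOn {G : Type u} [CommMonoid G] (R : G → Type v)
    [∀ g, AddCommGroup (R g)] where
  mul : ∀ {g h : G}, R g → R h → R (g * h)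
  one : R 1
  mul_add : ∀ {g h : G} (a : R g) (b c : R h), mul a (b + c) = mul a b + mul a c
  add_mul : ∀ {g h : G} (a b : R g) (c : R h), mul (a + b) c = mul a c + mul b c
  mul_assoc' : ∀ {g h k : G} (a : R g) (b : R h) (c : R k),
    dcast R (mul_assoc g h k) (mul (mul a b) c) = mul a (mul b c)
  mul_comm' : ∀ {g h : G} (a : R g) (b : R h),
    dcast R (mul_comm g h) (mul a b) = mul b a
  one_mul' : ∀ {g : G} (a : R g), dcast R (one_mul g) (mul one a) = a

/-- A dimensioned module over a dimensioned ring `R` (over the dimension monoid `G`),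
with dimension set `D` carrying a monoid action of `G`: a family of additive commutative
groups `A d` with biadditive scalar multiplications `R g → A d → A (g • d)` satisfying
`(r * s) • a = r • (s • a)` and `1 • a = a` up to canonical transport. -/
structure DimModOn {G : Type u} [CommMonoid G] {R : G → Type v} [∀ g, AddCommGroup (R g)]
    (S : DimRingOn R) {D : Type w} [MulAction G D]
    (A : D → Type x) [∀ d, AddCommGroup (A d)] where
  smul : ∀ {g : G} {d : D}, R g → A d → A (g • d)
  smul_add : ∀ {g : G} {d : D} (r : R g) (a b : A d), smul r (a + b) = smul r a + smul r b
  add_smul : ∀ {g : G} {d : D} (r s : R g) (a : A d), smul (r + s) a = smul r a + smul s a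
  mul_smul' : ∀ {g h : G} {d : D} (r : R g) (s : R h) (a : A d),
    dcast A (mul_smul g h d) (smul (S.mul r s) a) = smul r (smul s a)
  one_smul' : ∀ {d : D} (a : A d), dcast A (one_smul G d) (smul S.one a) = a

theorem dcast_mk {D : Type w} {A : D → Type x} [∀ d, AddCommGroup (A d)]
    (T : ∀ d, AddSubgroup (A d)) {d e : D} (h : d = e) (a : A d) :
    dcast (fun d => A d ⧸ T d) h (QuotientAddGroup.mk a) = QuotientAddGroup.mk (dcast A h a) := by
  subst h
  rfl

namespace DimModOn

variable {G : Type u} [CommMonoid G] {R : G → Type v} [∀ g, AddCommGroup (R g)]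
  {S : DimRingOn R} {D : Type w} [MulAction G D] {A : D → Type x} [∀ d, AddCommGroup (A d)]

/-- Scalar multiplication of a dimensioned module as a biadditive map. -/
def smulHom (M : DimModOn S A) (g : G) (d : D) : R g →+ A d →+ A (g • d) :=
  AddMonoidHom.mk' (fun r => AddMonoidHom.mk' (M.smul r) (M.smul_add r))
    fun r s => AddMonoidHom.ext (M.add_smul r s)

/-- The biadditive scalar multiplication induced on quotients. -/
def quotientSMul (M : DimModOn S A) (I : ∀ g, AddSubgroup (R g)) (T : ∀ d, AddSubgroup (A d))
    (hT : ∀ {g : G} {d : D} (r : R g) (a : A d), a ∈ T d → M.smul r a ∈ T (g • d))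
    (hIT : ∀ {g : G} {d : D} (i : R g) (a : A d), i ∈ I g → M.smul i a ∈ T (g • d))
    (g : G) (d : D) : R g ⧸ I g →+ A d ⧸ T d →+ A (g • d) ⧸ T (g • d) :=
  QuotientAddGroup.lift (I g)
    (AddMonoidHom.mk'
      (fun r => QuotientAddGroup.map (T d) (T (g • d)) (M.smulHom g d r) fun a ha => hT r a ha)
      fun r s => by
        ext a
        exact congrArg QuotientAddGroup.mk (M.add_smul r s a))
    fun i hi => by
      ext a
      exact (QuotientAddGroup.eq_zero_iff _).2 (hIT i a hi)

end DimModOn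

/-- **Quotient Dimensioned Module.** Let `A` be a dimensioned module over a
dimensioned ring `R`, `I` a dimensioned ideal of `R` and `T` a dimensioned submodule of `A`
with `I • A ⊆ T`. Then the family of quotient groups `d ↦ A d ⧸ T d` carries a well-defined
dimensioned module structure over the quotient dimensioned ring `g ↦ R g ⧸ I g`, uniquely
determined by `(r + I g) • (a + T d) = r • a + T (g • d)`; the quotient projections `Q`
satisfy `Q (r • a) = q r • Q a` where `q` is the quotient ring projection. -/
theorem quotient_dimensioned_module {G : Type u} [CommMonoid G]
    {R : G → Type v} [∀ g, AddCommGroup (R g)] (S : DimRingOn R)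
    {D : Type w} [MulAction G D] (A : D → Type x) [∀ d, AddCommGroup (A d)]
    (M : DimModOn S A)
    (I : ∀ g, AddSubgroup (R g))
    (hI : ∀ {g h : G} (r : R g) (i : R h), i ∈ I h → S.mul r i ∈ I (g * h))
    (T : ∀ d, AddSubgroup (A d))
    (hT : ∀ {g : G} {d : D} (r : R g) (a : A d), a ∈ T d → M.smul r a ∈ T (g • d))
    (hIT : ∀ {g : G} {d : D} (i : R g) (a : A d), i ∈ I g → M.smul i a ∈ T (g • d)) :
    ∃ Qsmul : ∀ (g : G) (d : D), (R g ⧸ I g) → (A d ⧸ T d) → (A (g • d) ⧸ T (g • d)),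
      -- uniquely determined by `(r + I g) • (a + T d) = r • a + T (g • d)`,
      -- i.e. `Q (r • a) = q r • Q a`:
      (∀ (g : G) (d : D) (r : R g) (a : A d),
        Qsmul g d (QuotientAddGroup.mk r) (QuotientAddGroup.mk a)
          = QuotientAddGroup.mk (M.smul r a)) ∧
      -- biadditive:
      (∀ (g : G) (d : D) (x : R g ⧸ I g) (y z : A d ⧸ T d),
        Qsmul g d x (y + z) = Qsmul g d x y + Qsmul g d x z) ∧
      (∀ (g : G) (d : D) (x y : R g ⧸ I g) (z : A d ⧸ T d),
        Qsmul g d (x + y) z = Qsmul g d x z + Qsmul g d y z) ∧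
      -- compatible with the quotient dimensioned ring multiplication:
      (∀ (g h : G) (d : D) (r : R g) (s : R h) (a : A d),
        dcast (fun d => A d ⧸ T d) (mul_smul g h d)
          (Qsmul (g * h) d (QuotientAddGroup.mk (S.mul r s)) (QuotientAddGroup.mk a))
          = Qsmul g (h • d) (QuotientAddGroup.mk r)
              (Qsmul h d (QuotientAddGroup.mk s) (QuotientAddGroup.mk a))) ∧
      -- unital:
      (∀ (d : D) (x : A d ⧸ T d),
        dcast (fun d => A d ⧸ T d) (one_smul G d)
          (Qsmul 1 d (QuotientAddGroup.mk S.one) x) = x) ∧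
      -- uniqueness:
      (∀ Qsmul' : ∀ (g : G) (d : D), (R g ⧸ I g) → (A d ⧸ T d) → (A (g • d) ⧸ T (g • d)),
        (∀ (g : G) (d : D) (r : R g) (a : A d),
          Qsmul' g d (QuotientAddGroup.mk r) (QuotientAddGroup.mk a)
            = QuotientAddGroup.mk (M.smul r a)) → Qsmul' = Qsmul) := by
  refine ⟨fun g d x y => M.quotientSMul I T hT hIT g d x y, fun _ _ _ _ => rfl,
    fun g d x => map_add (M.quotientSMul I T hT hIT g d x), fun g d x y z => ?_,
    fun g h d r s a => ?_, fun d x => ?_, fun Q hQ => ?_⟩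
  · simp only [map_add, AddMonoidHom.add_apply]
  · exact (dcast_mk T _ _).trans (congrArg QuotientAddGroup.mk (M.mul_smul' r s a))
  · induction x using QuotientAddGroup.induction_on with
    | H a => exact (dcast_mk T _ _).trans (congrArg QuotientAddGroup.mk (M.one_smul' a))
  · funext g d x y
    induction x using QuotientAddGroup.induction_on with
    | H r =>
      induction y using QuotientAddGroup.induction_on with
      | H a => exact hQ g d r a
end

section
/- Let G, D, E be commutative monoids, and suppose G acts on D and on E by monoid actions (g • (g' • d) = (g*g') • d, 1 • d = d, and similarly for E) satisfying the distributivity conditions g • (d * d') = (g • d) * d' for all g ∈ G, d, d' ∈ D, and g • (e * e') = (g • e) * e' for all g ∈ G, e, e' ∈ E. Then the relation on the product monoid D × E generated by (g • d, e) ∼ (d, g • e) for all g ∈ G, d ∈ D, e ∈ E is a monoid congruence, and consequently the quotient D ×^G E := (D × E)/∼ is a commutative monoid with multiplication [ (d, e) ] * [ (d', e') ] = [ (d*d', e*e') ]. -/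
/-- A relation on a commutative monoid that is stable under right multiplication generates an
equivalence relation that is compatible with multiplication. -/
theorem Relation.EqvGen.mul_of_mul_right {M : Type*} [CommMonoid M] {r : M → M → Prop}
    (hr : ∀ x y z, r x y → r (x * z) (y * z)) {w x y z : M}
    (hwx : Relation.EqvGen r w x) (hyz : Relation.EqvGen r y z) :
    Relation.EqvGen r (w * y) (x * z) := by
  have mul_right : ∀ {a b : M} (m : M), Relation.EqvGen r a b →
      Relation.EqvGen r (a * m) (b * m) := by
    intro a b m h
    induction h with
    | rel a b h => exact .rel _ _ (hr a b m h)
    | refl a => exact .refl _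
    | symm a b _ ih => exact .symm _ _ ih
    | trans a b c _ _ ih₁ ih₂ => exact .trans _ _ _ ih₁ ih₂
  refine .trans _ _ _ (mul_right y hwx) ?_
  rw [mul_comm x y, mul_comm x z]
  exact mul_right x hyz

/-- Let `G`, `D`, `E` be commutative monoids with monoid actions of `G`
on `D` and on `E` satisfying `g • (d * d') = (g • d) * d'` and `g • (e * e') = (g • e) * e'`.
Then the relation on the product monoid `D × E` generated by `(g • d, e) ∼ (d, g • e)` is a
monoid congruence, so the quotient `D ×^G E := (D × E)/∼` is a commutative monoid with
multiplication `[(d, e)] * [(d', e')] = [(d * d', e * e')]`. -/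
theorem tensor_product_of_dimension_monoids (G D E : Type*) [CommMonoid G]
    [CommMonoid D] [CommMonoid E] [MulAction G D] [MulAction G E]
    (hD : ∀ (g : G) (d d' : D), g • (d * d') = (g • d) * d')
    (hE : ∀ (g : G) (e e' : E), g • (e * e') = (g • e) * e') :
    ∃ c : Con (D × E),
      -- `c` is the equivalence relation generated by `(g • d, e) ∼ (d, g • e)`:
      (∀ x y : D × E, c x y ↔ Relation.EqvGen
        (fun x y : D × E => ∃ (g : G) (d : D) (e : E), x = (g • d, e) ∧ y = (d, g • e))
        x y) ∧
      -- the quotient multiplication is induced by that of `D × E`: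
      (∀ x y : D × E, (↑x : c.Quotient) * ↑y = ↑(x * y)) ∧
      -- and the quotient is a commutative monoid:
      (∀ a q : c.Quotient, a * q = q * a) ∧
      (∀ a q r : c.Quotient, a * q * r = a * (q * r)) ∧
      (∀ a : c.Quotient, (↑(1 : D × E) : c.Quotient) * a = a) := by
  refine ⟨⟨Relation.EqvGen.setoid _, Relation.EqvGen.mul_of_mul_right ?_⟩,
    fun _ _ => Iff.rfl, fun _ _ => rfl, mul_comm, mul_assoc, one_mul⟩
  rintro _ _ ⟨d', e'⟩ ⟨g, d, e, rfl, rfl⟩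
  exact ⟨g, d * d', e * e', by rw [hD, Prod.mk_mul_mk], by rw [hE, Prod.mk_mul_mk]⟩
end

section
/- Let A and B be commutative ℝ-algebras, each equipped with an ℝ-bilinear bracket {,}_A : A × A → A and {,}_B : B × B → B that is antisymmetric, satisfies the Jacobi identity, and is a derivation in each argument with respect to the algebra multiplication (Leibniz identity). Let u ∈ A and v ∈ B be Casimir elements, i.e. {u, a}_A = 0 for all a ∈ A and {v, b}_B = 0 for all b ∈ B. Then the ℝ-bilinear bracket on the tensor product algebra A ⊗[ℝ] B uniquely determined on elementary tensors by {a ⊗ b, a' ⊗ b'} := (u * {a, a'}_A) ⊗ (b * b') + (a * a') ⊗ (v * {b, b'}_B) is antisymmetric, satisfies the Jacobi identity, and satisfies the Leibniz identity with respect to the multiplication of A ⊗[ℝ] B; that is, it makes A ⊗[ℝ] B a Poisson algebra. -/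
open TensorProduct

section CasimirTwistedBracket

variable {R A B : Type*} [CommRing R] [CommRing A] [CommRing B] [Algebra R A] [Algebra R B]

/-- The bracket on `A ⊗[R] B` sending `(a ⊗ₜ b, a' ⊗ₜ b')` to
`(u * bA a a') ⊗ₜ (b * b') + (a * a') ⊗ₜ (v * bB b b')`. -/
noncomputable def casimirTwistedBracket (bA : A →ₗ[R] A →ₗ[R] A) (bB : B →ₗ[R] B →ₗ[R] B)
    (u : A) (v : B) : (A ⊗[R] B) →ₗ[R] (A ⊗[R] B) →ₗ[R] (A ⊗[R] B) :=
  TensorProduct.map₂ (bA.compr₂ (LinearMap.mulLeft R u)) (LinearMap.mul R B) +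
    TensorProduct.map₂ (LinearMap.mul R A) (bB.compr₂ (LinearMap.mulLeft R v))

theorem casimirTwistedBracket_tmul (bA : A →ₗ[R] A →ₗ[R] A) (bB : B →ₗ[R] B →ₗ[R] B)
    (u : A) (v : B) (a a' : A) (b b' : B) :
    casimirTwistedBracket bA bB u v (a ⊗ₜ b) (a' ⊗ₜ b') =
      (u * bA a a') ⊗ₜ (b * b') + (a * a') ⊗ₜ (v * bB b b') := by
  simp [casimirTwistedBracket]

theorem tmul_eq_includeLeft_mul_includeRight (a : A) (b : B) :
    a ⊗ₜ[R] b = (Algebra.TensorProduct.includeLeft : A →ₐ[R] A ⊗[R] B) a *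
      (Algebra.TensorProduct.includeRight : B →ₐ[R] A ⊗[R] B) b := by
  simp

theorem leibniz_left {bA : A →ₗ[R] A →ₗ[R] A} (hanti : ∀ a a' : A, bA a a' = - bA a' a)
    (hleib : ∀ a a' a'' : A, bA a (a' * a'') = bA a a' * a'' + a' * bA a a'') (a a' a'' : A) :
    bA (a * a') a'' = bA a a'' * a' + a * bA a' a'' := by
  rw [hanti, hleib, hanti a'' a, hanti a'' a']
  ring

theorem casimirTwistedBracket_antisymm {bA : A →ₗ[R] A →ₗ[R] A} {bB : B →ₗ[R] B →ₗ[R] B}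
    (hAanti : ∀ a a' : A, bA a a' = - bA a' a) (hBanti : ∀ b b' : B, bB b b' = - bB b' b)
    (u : A) (v : B) (x y : A ⊗[R] B) :
    casimirTwistedBracket bA bB u v x y = - casimirTwistedBracket bA bB u v y x := by
  induction x with
  | zero => simp
  | add x₁ x₂ h₁ h₂ => simp only [map_add, LinearMap.add_apply, h₁, h₂]; abel
  | tmul a b =>
    induction y with
    | zero => simp
    | add y₁ y₂ h₁ h₂ => simp only [map_add, LinearMap.add_apply, h₁, h₂]; abel
    | tmul a' b' =>
      rw [casimirTwistedBracket_tmul, casimirTwistedBracket_tmul, hAanti a a', hBanti b b',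
        mul_comm a a', mul_comm b b']
      simp only [mul_neg, TensorProduct.neg_tmul, TensorProduct.tmul_neg]
      abel

theorem casimirTwistedBracket_leibniz {bA : A →ₗ[R] A →ₗ[R] A} {bB : B →ₗ[R] B →ₗ[R] B}
    (hAleib : ∀ a a' a'' : A, bA a (a' * a'') = bA a a' * a'' + a' * bA a a'')
    (hBleib : ∀ b b' b'' : B, bB b (b' * b'') = bB b b' * b'' + b' * bB b b'')
    (u : A) (v : B) (x y z : A ⊗[R] B) :
    casimirTwistedBracket bA bB u v x (y * z) =
      casimirTwistedBracket bA bB u v x y * z + y * casimirTwistedBracket bA bB u v x z := by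
  induction x with
  | zero => simp
  | add x₁ x₂ h₁ h₂ => simp only [map_add, LinearMap.add_apply, h₁, h₂]; ring
  | tmul a b =>
    induction y with
    | zero => simp
    | add y₁ y₂ h₁ h₂ => simp only [map_add, add_mul, h₁, h₂]; ring
    | tmul a' b' =>
      induction z with
      | zero => simp
      | add z₁ z₂ h₁ h₂ => simp only [map_add, mul_add, h₁, h₂]; ring
      | tmul a'' b'' =>
        simp only [Algebra.TensorProduct.tmul_mul_tmul, casimirTwistedBracket_tmul, hAleib, hBleib]
        simp only [tmul_eq_includeLeft_mul_includeRight, map_add, map_mul]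
        ring

theorem casimirTwistedBracket_jacobi {bA : A →ₗ[R] A →ₗ[R] A} {bB : B →ₗ[R] B →ₗ[R] B}
    (hAanti : ∀ a a' : A, bA a a' = - bA a' a)
    (hAjac : ∀ a a' a'' : A, bA a (bA a' a'') = bA (bA a a') a'' + bA a' (bA a a''))
    (hAleib : ∀ a a' a'' : A, bA a (a' * a'') = bA a a' * a'' + a' * bA a a'')
    (hBanti : ∀ b b' : B, bB b b' = - bB b' b)
    (hBjac : ∀ b b' b'' : B, bB b (bB b' b'') = bB (bB b b') b'' + bB b' (bB b b''))
    (hBleib : ∀ b b' b'' : B, bB b (b' * b'') = bB b b' * b'' + b' * bB b b'')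
    {u : A} (hu : ∀ a : A, bA u a = 0) {v : B} (hv : ∀ b : B, bB v b = 0) (x y z : A ⊗[R] B) :
    casimirTwistedBracket bA bB u v x (casimirTwistedBracket bA bB u v y z) =
      casimirTwistedBracket bA bB u v (casimirTwistedBracket bA bB u v x y) z +
        casimirTwistedBracket bA bB u v y (casimirTwistedBracket bA bB u v x z) := by
  have hu' (a : A) : bA a u = 0 := by rw [hAanti, hu, neg_zero]
  have hv' (b : B) : bB b v = 0 := by rw [hBanti, hv, neg_zero]
  induction x with
  | zero => simp
  | add x₁ x₂ h₁ h₂ => simp only [map_add, LinearMap.add_apply, h₁, h₂]; abel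
  | tmul a b =>
    induction y with
    | zero => simp
    | add y₁ y₂ h₁ h₂ => simp only [map_add, LinearMap.add_apply, h₁, h₂]; abel
    | tmul a' b' =>
      induction z with
      | zero => simp
      | add z₁ z₂ h₁ h₂ => simp only [map_add, h₁, h₂]; abel
      | tmul a'' b'' =>
        simp only [casimirTwistedBracket_tmul, map_add, LinearMap.add_apply, hAleib, hBleib,
          leibniz_left hAanti hAleib, leibniz_left hBanti hBleib, hu, hu', hv, hv']
        rw [hAjac a a' a'', hBjac b b' b'', hAanti a' a, hBanti b' b]
        simp only [tmul_eq_includeLeft_mul_includeRight, map_add, map_mul, map_neg, map_zero]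
        ring

end CasimirTwistedBracket

/-- **Casimir-twisted tensor product of Poisson brackets.** Let `A`, `B` be
commutative ℝ-algebras with ℝ-bilinear, antisymmetric, Jacobi, Leibniz brackets, and let
`u ∈ A`, `v ∈ B` be Casimir elements. Then the ℝ-bilinear bracket on `A ⊗[ℝ] B` uniquely
determined on elementary tensors by
`{a ⊗ b, a' ⊗ b'} = (u * {a, a'}_A) ⊗ (b * b') + (a * a') ⊗ (v * {b, b'}_B)` is
antisymmetric, satisfies the Jacobi identity, and satisfies the Leibniz identity; that is,
it makes `A ⊗[ℝ] B` a Poisson algebra. -/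
theorem casimir_twisted_tensor_poisson (A B : Type*) [CommRing A] [CommRing B]
    [Algebra ℝ A] [Algebra ℝ B]
    (bA : A →ₗ[ℝ] A →ₗ[ℝ] A) (bB : B →ₗ[ℝ] B →ₗ[ℝ] B)
    (hAanti : ∀ a a' : A, bA a a' = - bA a' a)
    (hAjac : ∀ a a' a'' : A, bA a (bA a' a'') = bA (bA a a') a'' + bA a' (bA a a''))
    (hAleib : ∀ a a' a'' : A, bA a (a' * a'') = bA a a' * a'' + a' * bA a a'')
    (hBanti : ∀ b b' : B, bB b b' = - bB b' b)
    (hBjac : ∀ b b' b'' : B, bB b (bB b' b'') = bB (bB b b') b'' + bB b' (bB b b''))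
    (hBleib : ∀ b b' b'' : B, bB b (b' * b'') = bB b b' * b'' + b' * bB b b'')
    (u : A) (hu : ∀ a : A, bA u a = 0)
    (v : B) (hv : ∀ b : B, bB v b = 0) :
    ∃ br : (A ⊗[ℝ] B) →ₗ[ℝ] (A ⊗[ℝ] B) →ₗ[ℝ] (A ⊗[ℝ] B),
      -- determined on elementary tensors by the Casimir-twisted formula:
      (∀ (a a' : A) (b b' : B),
        br (a ⊗ₜ b) (a' ⊗ₜ b')
          = (u * bA a a') ⊗ₜ (b * b') + (a * a') ⊗ₜ (v * bB b b')) ∧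
      -- antisymmetric:
      (∀ x y : A ⊗[ℝ] B, br x y = - br y x) ∧
      -- Jacobi:
      (∀ x y z : A ⊗[ℝ] B, br x (br y z) = br (br x y) z + br y (br x z)) ∧
      -- Leibniz with respect to the multiplication of `A ⊗[ℝ] B`:
      (∀ x y z : A ⊗[ℝ] B, br x (y * z) = br x y * z + y * br x z) ∧
      -- uniqueness:
      (∀ br' : (A ⊗[ℝ] B) →ₗ[ℝ] (A ⊗[ℝ] B) →ₗ[ℝ] (A ⊗[ℝ] B),
        (∀ (a a' : A) (b b' : B),
          br' (a ⊗ₜ b) (a' ⊗ₜ b')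
            = (u * bA a a') ⊗ₜ (b * b') + (a * a') ⊗ₜ (v * bB b b')) → br' = br) := by
  exact ⟨casimirTwistedBracket bA bB u v, casimirTwistedBracket_tmul bA bB u v,
    casimirTwistedBracket_antisymm hAanti hBanti u v,
    casimirTwistedBracket_jacobi hAanti hAjac hAleib hBanti hBjac hBleib hu hv,
    casimirTwistedBracket_leibniz hAleib hBleib u v, fun br' h => by
      ext a b a' b'
      simpa [casimirTwistedBracket_tmul] using h a a' b b'⟩
end
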